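/- Let P, Q be Borel probability measures on ℝ^d satisfying the continuity assumption, and let ϑ ∈ (0,1). Let X1, X2, X3 be i.i.d. with law P and, independently, Y1, Y2, Y3 i.i.d. with law Q. Then W_d²(P,Q) = (1/(2π))·E[Ang(X1−X2, Y1−X2)] + (1/(2π))·E[Ang(X1−Y2, Y1−Y2)] − (1/(4π))·E[Ang(X1−X3, X2−X3)] − (1/(4π))·E[Ang(X1−Y1, X2−Y1)] − (1/(4π))·E[Ang(Y1−Y3, Y2−Y3)] − (1/(4π))·E[Ang(Y1−X1, Y2−X1)], where all angle arguments are nonzero almost surely under the continuity assumption. -/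

import Mathlib

open MeasureTheory ProbabilityTheory Real
open scoped RealInnerProductSpace ENNReal BigOperators

noncomputable section

/-- The standard Gaussian measure on `ℝ^d = EuclideanSpace ℝ (Fin d)`. -/
def stdGaussian (d : ℕ) : Measure (EuclideanSpace ℝ (Fin d)) :=
  (Measure.pi fun _ : Fin d => gaussianReal 0 1).map
    ⇑(EuclideanSpace.equiv (Fin d) ℝ).symm

/-- The uniform (rotation-invariant) probability measure `λ` on the unit sphere
`S^{d-1} = {x : ‖x‖ = 1} ⊆ ℝ^d`, realized as a Borel measure on `ℝ^d` concentrated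
on the sphere: the pushforward of the standard Gaussian under `x ↦ ‖x‖⁻¹ • x`. -/
def sphereUniform (d : ℕ) : Measure (EuclideanSpace ℝ (Fin d)) :=
  (stdGaussian d).map fun x => ‖x‖⁻¹ • x

/-- `Ang u v = arccos (⟪u,v⟫ / (‖u‖ ‖v‖)) ∈ [0, π]`, the angle between two nonzero vectors. -/
def Ang {d : ℕ} (u v : EuclideanSpace ℝ (Fin d)) : ℝ :=
  Real.arccos (⟪u, v⟫ / (‖u‖ * ‖v‖))

/-- Law of the projection `x ↦ ⟪β, x⟫` under `P`. -/
def projLaw {d : ℕ} (P : Measure (EuclideanSpace ℝ (Fin d)))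
    (β : EuclideanSpace ℝ (Fin d)) : Measure ℝ :=
  P.map fun x => ⟪β, x⟫

/-- `F_{β,P}(t) = P {x : ⟪β,x⟫ ≤ t}`. -/
def projCDF {d : ℕ} (P : Measure (EuclideanSpace ℝ (Fin d)))
    (β : EuclideanSpace ℝ (Fin d)) (t : ℝ) : ℝ :=
  (P {x | ⟪β, x⟫ ≤ t}).toReal

/-- The squared Cramér–von Mises distance `W_d²(P,Q)` with weight `ϑ`:
`∫_{S^{d-1}} ∫_ℝ (F_{β,P}(t) - F_{β,Q}(t))² dH_β(t) dλ(β)` where `H_β` is the law of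
`x ↦ ⟪β,x⟫` under the mixture `ϑ•P + (1-ϑ)•Q`. -/
def cvmSq {d : ℕ} (ϑ : ℝ) (P Q : Measure (EuclideanSpace ℝ (Fin d))) : ℝ :=
  ∫ β, (∫ t, (projCDF P β t - projCDF Q β t) ^ 2
      ∂(projLaw (ENNReal.ofReal ϑ • P + ENNReal.ofReal (1 - ϑ) • Q) β))
    ∂(sphereUniform d)

/-- The continuity assumption: for `λ`-a.e. `β`, the pushforwards of `P` and `Q`
under `x ↦ ⟪β,x⟫` are atomless. -/
def ContinuityAssumption {d : ℕ} (P Q : Measure (EuclideanSpace ℝ (Fin d))) : Prop :=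
  ∀ᵐ β ∂(sphereUniform d),
    (∀ t : ℝ, projLaw P β {t} = 0) ∧ (∀ t : ℝ, projLaw Q β {t} = 0)


lemma meas_two {α : Type*} [MeasurableSpace α] {f g : α → ℝ} (hf : Measurable f)
    (hg : Measurable g) : MeasurableSet {a | f a ≤ 0 ∧ g a ≤ 0} :=
  (measurableSet_le hf measurable_const).inter (measurableSet_le hg measurable_const)

lemma stdGaussian_eq (d : ℕ) :
    _root_.stdGaussian d = ProbabilityTheory.stdGaussian (EuclideanSpace ℝ (Fin d)) := by
  rw [← map_pi_eq_stdGaussian]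
  rfl

instance instProbStd (d : ℕ) : IsProbabilityMeasure (_root_.stdGaussian d) := by
  rw [stdGaussian_eq]; infer_instance

instance instProbSphere (d : ℕ) : IsProbabilityMeasure (sphereUniform d) :=
  Measure.isProbabilityMeasure_map (Measurable.aemeasurable (by fun_prop))

lemma law_pair {d : ℕ} (u v : EuclideanSpace ℝ (Fin d)) (hu : ‖u‖ = 1) (hv : ‖v‖ = 1)
    (c s : ℝ) (h1 : c ^ 2 + s ^ 2 = 1) (h2 : c ^ 2 - s ^ 2 = ⟪u, v⟫) :
    (_root_.stdGaussian d).map (fun x => (!₂[⟪x, u⟫, ⟪x, v⟫] : EuclideanSpace ℝ (Fin 2)))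
    = ((gaussianReal 0 1).prod (gaussianReal 0 1)).map
      (fun p : ℝ × ℝ => (!₂[-c * p.1 + s * p.2, -c * p.1 - s * p.2] : EuclideanSpace ℝ (Fin 2))) := by
  have m1 : Measurable (fun x : EuclideanSpace ℝ (Fin d) =>
      (!₂[⟪x, u⟫, ⟪x, v⟫] : EuclideanSpace ℝ (Fin 2))) := by
    apply Continuous.measurable; fun_prop
  have m2 : Measurable (fun p : ℝ × ℝ =>
      (!₂[-c * p.1 + s * p.2, -c * p.1 - s * p.2] : EuclideanSpace ℝ (Fin 2))) := by
    apply Continuous.measurable; fun_prop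
  have := Measure.isProbabilityMeasure_map (μ := _root_.stdGaussian d) m1.aemeasurable
  have := Measure.isProbabilityMeasure_map
    (μ := ((gaussianReal 0 1).prod (gaussianReal 0 1))) m2.aemeasurable
  apply Measure.ext_of_charFun
  ext t
  rw [charFun_apply, charFun_apply, integral_map m1.aemeasurable (by fun_prop),
    integral_map m2.aemeasurable (by fun_prop)]
  have e1 : ∀ x : EuclideanSpace ℝ (Fin d),
      ⟪(!₂[⟪x, u⟫, ⟪x, v⟫] : EuclideanSpace ℝ (Fin 2)), t⟫ = ⟪x, t 0 • u + t 1 • v⟫ := by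
    intro x
    simp [PiLp.inner_apply, Fin.sum_univ_two, inner_add_right, inner_smul_right]
  have e2 : ∀ p : ℝ × ℝ,
      Complex.exp (((⟪(!₂[-c * p.1 + s * p.2, -c * p.1 - s * p.2] : EuclideanSpace ℝ (Fin 2)), t⟫ : ℝ) : ℂ)
        * Complex.I)
      = Complex.exp (((-c * (t 0 + t 1) : ℝ) : ℂ) * p.1 * Complex.I)
        * Complex.exp (((s * (t 0 - t 1) : ℝ) : ℂ) * p.2 * Complex.I) := by
    intro p
    rw [← Complex.exp_add]
    congr 1
    simp [PiLp.inner_apply, Fin.sum_univ_two]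
    ring
  simp_rw [e1, e2]
  rw [integral_prod_mul (fun a : ℝ => Complex.exp (((-c * (t 0 + t 1) : ℝ) : ℂ) * a * Complex.I))
    (fun a : ℝ => Complex.exp (((s * (t 0 - t 1) : ℝ) : ℂ) * a * Complex.I)),
    ← charFun_apply, stdGaussian_eq, charFun_stdGaussian, ← charFun_apply_real,
    ← charFun_apply_real, charFun_gaussianReal, charFun_gaussianReal, ← Complex.exp_add]
  congr 1
  have e3 : ‖t 0 • u + t 1 • v‖ ^ 2 = t 0 ^ 2 + t 1 ^ 2 + 2 * t 0 * t 1 * (c ^ 2 - s ^ 2) := by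
    rw [h2, norm_add_sq_real, norm_smul, norm_smul, inner_smul_left, inner_smul_right, hu, hv]
    simp; ring
  have e4 : ‖t 0 • u + t 1 • v‖ ^ 2 = (c * (t 0 + t 1)) ^ 2 + (s * (t 0 - t 1)) ^ 2 := by
    rw [e3]; linear_combination (-(t 0 ^ 2 + t 1 ^ 2)) * h1
  rw [← Complex.ofReal_pow, e4]
  simp
  ring

lemma gauss2_orthant (θ : ℝ) (h0 : 0 ≤ θ) (hπ : θ ≤ π) :
    ((gaussianReal 0 1).prod (gaussianReal 0 1)).real
      {p : ℝ × ℝ | -cos (θ / 2) * p.1 + sin (θ / 2) * p.2 ≤ 0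
        ∧ -cos (θ / 2) * p.1 - sin (θ / 2) * p.2 ≤ 0} = (π - θ) / (2 * π) := by
  set S := {p : ℝ × ℝ | -cos (θ / 2) * p.1 + sin (θ / 2) * p.2 ≤ 0
        ∧ -cos (θ / 2) * p.1 - sin (θ / 2) * p.2 ≤ 0} with hS
  have mS : MeasurableSet S := by
    apply meas_two <;> fun_prop
  rw [gaussianReal_of_var_ne_zero 0 one_ne_zero, prod_withDensity (by fun_prop) (by fun_prop),
    ← Measure.volume_eq_prod, measureReal_def, withDensity_apply _ mS]
  have e0 : ∀ p : ℝ × ℝ, gaussianPDF 0 1 p.1 * gaussianPDF 0 1 p.2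
      = ENNReal.ofReal ((2 * π)⁻¹ * exp (-(1 / 2) * (p.1 ^ 2 + p.2 ^ 2))) := by
    intro p
    rw [gaussianPDF, gaussianPDF, ← ENNReal.ofReal_mul (gaussianPDFReal_nonneg _ _ _)]
    congr 1
    simp only [gaussianPDFReal, NNReal.coe_one, mul_one, sub_zero]
    have : (√(2 * π))⁻¹ * (√(2 * π))⁻¹ = (2 * π)⁻¹ := by
      rw [← mul_inv, Real.mul_self_sqrt (by positivity)]
    rw [mul_mul_mul_comm, this, ← exp_add]
    congr 2; ring
  simp_rw [e0]
  rw [← integral_eq_lintegral_of_nonneg_ae (Filter.Eventually.of_forall fun p => by positivity)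
    (Continuous.aestronglyMeasurable (by fun_prop)), ← integral_indicator mS,
    ← integral_comp_polarCoord_symm]
  set I := Set.Icc (-(π / 2 - θ / 2)) (π / 2 - θ / 2) with hI
  have e1 : ∀ p ∈ polarCoord.target,
      p.1 • S.indicator (fun p : ℝ × ℝ => (2 * π)⁻¹ * exp (-(1 / 2) * (p.1 ^ 2 + p.2 ^ 2)))
        (polarCoord.symm p)
      = (p.1 * exp (-(1 / 2) * p.1 ^ (2 : ℝ))) * (I.indicator (fun _ => (2 * π)⁻¹) p.2) := by
    rintro ⟨r, α⟩ ⟨hr, hα⟩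
    simp only [Set.mem_Ioi] at hr
    simp only [Set.mem_Ioo] at hα
    have hmem : polarCoord.symm (r, α) ∈ S ↔ α ∈ I := by
      have a1 : -cos (θ / 2) * (r * cos α) + sin (θ / 2) * (r * sin α)
          = -(r * cos (α + θ / 2)) := by rw [cos_add]; ring
      have a2 : -cos (θ / 2) * (r * cos α) - sin (θ / 2) * (r * sin α)
          = -(r * cos (α - θ / 2)) := by rw [cos_sub]; ring
      simp only [polarCoord_symm_apply, hS, hI, Set.mem_ofPred_eq, Set.mem_Icc, a1, a2]
      rw [neg_nonpos, neg_nonpos, mul_nonneg_iff_of_pos_left hr, mul_nonneg_iff_of_pos_left hr]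
      constructor
      · rintro ⟨b1, b2⟩
        constructor
        · by_contra! h
          have : cos (α - θ / 2) < 0 := by
            rw [← cos_neg]
            apply cos_neg_of_pi_div_two_lt_of_lt <;> linarith
          linarith
        · by_contra! h
          have : cos (α + θ / 2) < 0 := by
            apply cos_neg_of_pi_div_two_lt_of_lt <;> linarith
          linarith
      · rintro ⟨b1, b2⟩
        constructor <;> apply cos_nonneg_of_mem_Icc <;> constructor <;> linarith
    have hsq : (r * cos α) ^ 2 + (r * sin α) ^ 2 = r ^ (2 : ℝ) := by
      rw [rpow_two]; nlinarith [sin_sq_add_cos_sq α]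
    by_cases h : α ∈ I
    · rw [Set.indicator_of_mem (hmem.2 h), Set.indicator_of_mem (by exact h)]
      simp only [polarCoord_symm_apply, hsq, smul_eq_mul]; ring
    · rw [Set.indicator_of_notMem (fun h' => h (hmem.1 h')), Set.indicator_of_notMem (by exact h)]
      simp
  rw [setIntegral_congr_fun (polarCoord.open_target.measurableSet) e1, polarCoord_target,
    Measure.volume_eq_prod, setIntegral_prod_mul (fun r : ℝ => r * exp (-(1 / 2) * r ^ (2 : ℝ)))
      (I.indicator (fun _ => (2 * π)⁻¹))]
  have e2 := integral_rpow_mul_exp_neg_mul_rpow (p := 2) (q := 1) (b := 1 / 2) (by norm_num)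
    (by norm_num) (by norm_num)
  simp only [rpow_one] at e2
  rw [e2, integral_indicator measurableSet_Icc, Measure.restrict_restrict measurableSet_Icc]
  have e3 : (volume.real (I ∩ Set.Ioo (-π) π)) = π - θ := by
    have : I ∩ Set.Ioo (-π) π = I := by
      apply Set.inter_eq_left.2
      intro x hx
      simp only [hI, Set.mem_Icc] at hx
      constructor <;> linarith [pi_pos]
    rw [this, hI, volume_real_Icc_of_le (by linarith)]; ring
  rw [setIntegral_const, e3]
  norm_num [Real.Gamma_one, rpow_neg_one]
  field_simp

lemma Ang_eq {d : ℕ} (u v : EuclideanSpace ℝ (Fin d)) : Ang u v = InnerProductGeometry.angle u v :=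
  rfl

lemma orthant {d : ℕ} (u v : EuclideanSpace ℝ (Fin d)) (hu : u ≠ 0) (hv : v ≠ 0) :
    (sphereUniform d).real {β | ⟪β, u⟫ ≤ 0 ∧ ⟪β, v⟫ ≤ 0} = 1 / 2 - Ang u v / (2 * π) := by
  set θ := Ang u v with hθ
  set u' := ‖u‖⁻¹ • u
  set v' := ‖v‖⁻¹ • v
  have hu0 : 0 < ‖u‖ := norm_pos_iff.2 hu
  have hv0 : 0 < ‖v‖ := norm_pos_iff.2 hv
  have hu' : ‖u'‖ = 1 := by simp [u', norm_smul, hu0.ne']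
  have hv' : ‖v'‖ = 1 := by simp [v', norm_smul, hv0.ne']
  have hcos : cos θ = ⟪u', v'⟫ := by
    rw [hθ, Ang_eq, InnerProductGeometry.cos_angle]
    simp only [u', v', inner_smul_left, inner_smul_right]
    simp; field_simp
  have L := law_pair u' v' hu' hv' (cos (θ / 2)) (sin (θ / 2)) (by rw [cos_sq_add_sin_sq])
    (by rw [← hcos, ← cos_two_mul']; congr 1; ring)
  have G := gauss2_orthant θ (InnerProductGeometry.angle_nonneg _ _)
    (InnerProductGeometry.angle_le_pi _ _)
  have mO : MeasurableSet {z : EuclideanSpace ℝ (Fin 2) | z 0 ≤ 0 ∧ z 1 ≤ 0} := by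
    apply meas_two <;> fun_prop
  have m1 : Measurable (fun x : EuclideanSpace ℝ (Fin d) =>
      (!₂[⟪x, u'⟫, ⟪x, v'⟫] : EuclideanSpace ℝ (Fin 2))) := by
    apply Continuous.measurable; fun_prop
  have m2 : Measurable (fun p : ℝ × ℝ =>
      (!₂[-cos (θ / 2) * p.1 + sin (θ / 2) * p.2, -cos (θ / 2) * p.1 - sin (θ / 2) * p.2] :
        EuclideanSpace ℝ (Fin 2))) := by
    apply Continuous.measurable; fun_prop
  have L2 := congrArg (fun μ => μ.real {z : EuclideanSpace ℝ (Fin 2) | z 0 ≤ 0 ∧ z 1 ≤ 0}) L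
  simp only at L2
  rw [map_measureReal_apply m1 mO, map_measureReal_apply m2 mO] at L2
  have mT : MeasurableSet {β : EuclideanSpace ℝ (Fin d) | ⟪β, u⟫ ≤ 0 ∧ ⟪β, v⟫ ≤ 0} := by
    apply meas_two <;> fun_prop
  have e1 : (fun p : ℝ × ℝ =>
      (!₂[-cos (θ / 2) * p.1 + sin (θ / 2) * p.2, -cos (θ / 2) * p.1 - sin (θ / 2) * p.2] :
        EuclideanSpace ℝ (Fin 2))) ⁻¹' {z : EuclideanSpace ℝ (Fin 2) | z 0 ≤ 0 ∧ z 1 ≤ 0}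
      = {p : ℝ × ℝ | -cos (θ / 2) * p.1 + sin (θ / 2) * p.2 ≤ 0
        ∧ -cos (θ / 2) * p.1 - sin (θ / 2) * p.2 ≤ 0} := by
    ext p; simp
  rw [e1, G] at L2
  have key : ∀ (x w : EuclideanSpace ℝ (Fin d)), ⟪‖x‖⁻¹ • x, w⟫ ≤ 0 ↔ ⟪x, w⟫ ≤ 0 := by
    intro x w
    rcases eq_or_ne x 0 with rfl | hx
    · simp
    · have : 0 < ‖x‖⁻¹ := inv_pos.2 (norm_pos_iff.2 hx)
      rw [real_inner_smul_left]
      exact ⟨fun h => by by_contra! h2; linarith [mul_pos this h2], fun h => mul_nonpos_of_nonneg_of_nonpos this.le h⟩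
  have key2 : ∀ (x w : EuclideanSpace ℝ (Fin d)), w ≠ 0 → (⟪x, ‖w‖⁻¹ • w⟫ ≤ 0 ↔ ⟪x, w⟫ ≤ 0) := by
    intro x w hw
    rw [real_inner_comm, real_inner_comm w x]
    exact (key w x)
  rw [sphereUniform, map_measureReal_apply (by fun_prop) mT]
  have e2 : (fun x : EuclideanSpace ℝ (Fin d) => ‖x‖⁻¹ • x) ⁻¹' {β | ⟪β, u⟫ ≤ 0 ∧ ⟪β, v⟫ ≤ 0}
    = (fun x : EuclideanSpace ℝ (Fin d) =>
      (!₂[⟪x, u'⟫, ⟪x, v'⟫] : EuclideanSpace ℝ (Fin 2))) ⁻¹'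
        {z : EuclideanSpace ℝ (Fin 2) | z 0 ≤ 0 ∧ z 1 ≤ 0} := by
    ext x
    simp only [Set.mem_preimage, Set.mem_ofPred_eq, key]
    simp [u', v', key2 x u hu, key2 x v hv]
  rw [e2, L2]
  field_simp

lemma measurable_Ang {d : ℕ} {α : Type*} [MeasurableSpace α] {f g : α → EuclideanSpace ℝ (Fin d)}
    (hf : Measurable f) (hg : Measurable g) : Measurable fun a => Ang (f a) (g a) := by
  unfold Ang
  fun_prop

lemma integrable_Ang {d : ℕ} {α : Type*} [MeasurableSpace α] {f g : α → EuclideanSpace ℝ (Fin d)}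
    (μ : Measure α) [IsFiniteMeasure μ]
    (hf : Measurable f) (hg : Measurable g) : Integrable (fun a => Ang (f a) (g a)) μ := by
  refine Integrable.of_bound (measurable_Ang hf hg).aestronglyMeasurable π
    (Filter.Eventually.of_forall fun a => ?_)
  rw [Ang_eq, Real.norm_of_nonneg (InnerProductGeometry.angle_nonneg _ _)]
  exact InnerProductGeometry.angle_le_pi _ _

/-- The iterated angle functional. -/
def TT {d : ℕ} (A B C : Measure (EuclideanSpace ℝ (Fin d))) : ℝ :=
  ∫ a, ∫ b, ∫ c, Ang (a - c) (b - c) ∂C ∂B ∂A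

/-- The CDF functional. -/
def II {d : ℕ} (A B C : Measure (EuclideanSpace ℝ (Fin d))) (β : EuclideanSpace ℝ (Fin d)) : ℝ :=
  ∫ t, projCDF A β t * projCDF B β t ∂(projLaw C β)

section
variable {d : ℕ} (A B C : Measure (EuclideanSpace ℝ (Fin d)))
    [IsProbabilityMeasure A] [IsProbabilityMeasure B] [IsProbabilityMeasure C]

lemma TT_eq_prod : TT A B C = ∫ z, Ang (z.1.1 - z.2) (z.1.2 - z.2) ∂((A.prod B).prod C) := by
  have h := integrable_Ang ((A.prod B).prod C)
    (f := fun z => z.1.1 - z.2) (g := fun z => z.1.2 - z.2) (by fun_prop) (by fun_prop)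
  rw [integral_prod _ h, integral_prod _ h.integral_prod_left, TT]

lemma TT_swap23 : (∫ a, ∫ c, ∫ b, Ang (a - c) (b - c) ∂B ∂C ∂A) = TT A B C := by
  rw [TT]
  congr 1
  ext a
  have h := integrable_Ang (C.prod B)
    (f := fun z => a - z.1) (g := fun z => z.2 - z.1) (by fun_prop) (by fun_prop)
  exact integral_integral_swap (f := fun c b => Ang (a - c) (b - c)) h

lemma Ang_comm (u v : EuclideanSpace ℝ (Fin d)) : Ang u v = Ang v u :=
  InnerProductGeometry.angle_comm u v

lemma TT_symm : TT A B C = TT B A C := by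
  have h := (integrable_Ang ((A.prod B).prod C)
    (f := fun z => z.1.1 - z.2) (g := fun z => z.1.2 - z.2)
    (by fun_prop) (by fun_prop)).integral_prod_left
  have h2 := integral_integral_swap (f := fun a b => ∫ c, Ang (a - c) (b - c) ∂C) h
  rw [TT, TT, h2]
  congr 1; ext b; congr 1; ext a; congr 1; ext c
  exact Ang_comm _ _

lemma ae_ne_prod [NullSingletonClass C] : ∀ᵐ z ∂((A.prod B).prod C), z.1.1 ≠ z.2 ∧ z.1.2 ≠ z.2 := by
  have m : MeasurableSet {z : (EuclideanSpace ℝ (Fin d) × EuclideanSpace ℝ (Fin d)) ×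
      EuclideanSpace ℝ (Fin d) | z.1.1 ≠ z.2 ∧ z.1.2 ≠ z.2} :=
    ((measurableSet_eq_fun (by fun_prop) (by fun_prop)).compl).inter
      ((measurableSet_eq_fun (by fun_prop) (by fun_prop)).compl)
  rw [Measure.ae_prod_iff_ae_ae m]
  refine Filter.Eventually.of_forall fun ab => ?_
  filter_upwards [Measure.ae_ne C ab.1, Measure.ae_ne C ab.2] with c h1 h2
  exact ⟨h1.symm, h2.symm⟩

/-- angle sum -/
lemma TT_sum [NullSingletonClass B] : TT A A B + 2 * TT A B A = π := by
  have h2 : TT A B A = ∫ z, Ang (z.1.2 - z.1.1) (z.2 - z.1.1) ∂((A.prod A).prod B) := by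
    have h := integrable_Ang ((A.prod A).prod B)
      (f := fun z => z.1.2 - z.1.1) (g := fun z => z.2 - z.1.1) (by fun_prop) (by fun_prop)
    rw [integral_prod _ h, integral_prod_symm _ h.integral_prod_left, ← TT_swap23]
  have h3 : TT A B A = ∫ z, Ang (z.1.1 - z.1.2) (z.2 - z.1.2) ∂((A.prod A).prod B) := by
    have h := integrable_Ang ((A.prod A).prod B)
      (f := fun z => z.1.1 - z.1.2) (g := fun z => z.2 - z.1.2) (by fun_prop) (by fun_prop)
    rw [integral_prod _ h, integral_prod _ h.integral_prod_left, ← TT_swap23]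
  have h1 := TT_eq_prod A A B
  have key : ∫ z, (Ang (z.1.1 - z.2) (z.1.2 - z.2) + Ang (z.1.2 - z.1.1) (z.2 - z.1.1)
      + Ang (z.1.1 - z.1.2) (z.2 - z.1.2)) ∂((A.prod A).prod B) = π := by
    rw [integral_congr_ae (g := fun _ => π)]
    · simp
    · filter_upwards [ae_ne_prod A A B] with z hz
      have := InnerProductGeometry.angle_add_angle_sub_add_angle_sub_eq_pi
        (z.1.1 - z.2) (y := z.1.2 - z.2) (sub_ne_zero.2 hz.2)
      simp only [Ang_eq]
      rw [← this]
      simp only [sub_sub_sub_cancel_right]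
      rw [InnerProductGeometry.angle_comm (z.1.1 - z.2) (z.1.1 - z.1.2),
        InnerProductGeometry.angle_comm (z.1.2 - z.2) (z.1.2 - z.1.1),
        ← InnerProductGeometry.angle_neg_neg (z.1.2 - z.1.1) (z.2 - z.1.1),
        ← InnerProductGeometry.angle_neg_neg (z.1.1 - z.1.2) (z.2 - z.1.2)]
      simp only [neg_sub]
  rw [integral_add, integral_add, ← h1, ← h2, ← h3] at key
  · linarith
  · exact integrable_Ang _ (by fun_prop) (by fun_prop)
  · exact integrable_Ang _ (by fun_prop) (by fun_prop)
  · exact (integrable_Ang _ (by fun_prop) (by fun_prop)).add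
      (integrable_Ang _ (by fun_prop) (by fun_prop))
  · exact integrable_Ang _ (by fun_prop) (by fun_prop)

lemma measurable_projCDF (β : EuclideanSpace ℝ (Fin d)) : Measurable (projCDF A β) := by
  apply Monotone.measurable
  intro s t hst
  exact measureReal_mono (μ := A) (fun x hx => le_trans hx hst)

lemma projCDF_nonneg (β : EuclideanSpace ℝ (Fin d)) (t : ℝ) : 0 ≤ projCDF A β t :=
  ENNReal.toReal_nonneg

lemma projCDF_le_one (β : EuclideanSpace ℝ (Fin d)) (t : ℝ) : projCDF A β t ≤ 1 :=
  measureReal_le_one (μ := A)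

instance instProbProj (β : EuclideanSpace ℝ (Fin d)) : IsProbabilityMeasure (projLaw C β) :=
  Measure.isProbabilityMeasure_map (Measurable.aemeasurable (by fun_prop))

lemma integrable_mul_projCDF (β : EuclideanSpace ℝ (Fin d)) (μ : Measure ℝ) [IsFiniteMeasure μ] :
    Integrable (fun t => projCDF A β t * projCDF B β t) μ := by
  refine Integrable.of_bound
    ((measurable_projCDF A β).mul (measurable_projCDF B β)).aestronglyMeasurable 1
    (Filter.Eventually.of_forall fun t => ?_)
  rw [Real.norm_of_nonneg (mul_nonneg (projCDF_nonneg A β t) (projCDF_nonneg B β t))]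
  exact mul_le_one₀ (projCDF_le_one A β t) (projCDF_nonneg B β t) (projCDF_le_one B β t)

/-- The joint event. -/
def SS (d : ℕ) : Set (EuclideanSpace ℝ (Fin d) × ((EuclideanSpace ℝ (Fin d) ×
    EuclideanSpace ℝ (Fin d)) × EuclideanSpace ℝ (Fin d))) :=
  {w | ⟪w.1, w.2.1.1 - w.2.2⟫ ≤ 0 ∧ ⟪w.1, w.2.1.2 - w.2.2⟫ ≤ 0}

lemma meas_SS : MeasurableSet (SS d) := by
  apply meas_two <;> fun_prop

lemma integrable_SS {α : Type*} [MeasurableSpace α] (μ : Measure α) [IsFiniteMeasure μ]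
    (f : α → EuclideanSpace ℝ (Fin d) × ((EuclideanSpace ℝ (Fin d) ×
    EuclideanSpace ℝ (Fin d)) × EuclideanSpace ℝ (Fin d))) (hf : Measurable f) :
    Integrable (fun a => (SS d).indicator (fun _ => (1 : ℝ)) (f a)) μ := by
  refine Integrable.of_bound
    ((measurable_const.indicator meas_SS).comp hf).aestronglyMeasurable 1
    (Filter.Eventually.of_forall fun t => ?_)
  simp only [Set.indicator]
  split_ifs <;> simp

lemma II_eq (β : EuclideanSpace ℝ (Fin d)) :
    II A B C β = ∫ z, (SS d).indicator (fun _ => (1 : ℝ)) (β, z) ∂((A.prod B).prod C) := by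
  rw [integral_prod_symm _ (integrable_SS _ (fun z => (β, z)) (by fun_prop)), II, projLaw,
    integral_map (by fun_prop) (by
      exact ((measurable_projCDF A β).mul (measurable_projCDF B β)).aestronglyMeasurable)]
  congr 1
  ext c
  have e : (fun ab : EuclideanSpace ℝ (Fin d) × EuclideanSpace ℝ (Fin d) =>
      (SS d).indicator (fun _ => (1 : ℝ)) (β, (ab, c)))
      = ({x | ⟪β, x⟫ ≤ ⟪β, c⟫} ×ˢ {x | ⟪β, x⟫ ≤ ⟪β, c⟫}).indicator 1 := by
    ext ab
    simp only [Set.indicator, SS, Set.mem_prod, Set.mem_ofPred_eq, inner_sub_right, sub_nonpos,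
      Pi.one_apply]
  have m : MeasurableSet {x : EuclideanSpace ℝ (Fin d) | ⟪β, x⟫ ≤ ⟪β, c⟫} :=
    measurableSet_le (by fun_prop) (by fun_prop)
  rw [e, integral_indicator_one (m.prod m), measureReal_prod_prod]
  rfl

lemma integrable_II : Integrable (II A B C) (sphereUniform d) := by
  have := (integrable_SS ((sphereUniform d).prod ((A.prod B).prod C))
    (fun w => w) (by fun_prop)).integral_prod_left
  refine this.congr (Filter.Eventually.of_forall fun β => ?_)
  rw [II_eq]

lemma integral_II [NullSingletonClass C] :
    ∫ β, II A B C β ∂(sphereUniform d) = 1 / 2 - TT A B C / (2 * π) := by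
  simp_rw [II_eq]
  rw [integral_integral_swap (integrable_SS ((sphereUniform d).prod ((A.prod B).prod C))
    (fun w => w) (by fun_prop))]
  rw [integral_congr_ae (g := fun z => 1 / 2 - Ang (z.1.1 - z.2) (z.1.2 - z.2) / (2 * π))]
  · rw [integral_sub (integrable_const _)
      ((integrable_Ang _ (by fun_prop) (by fun_prop)).div_const _), TT_eq_prod]
    simp
    exact integral_div _ _
  · filter_upwards [ae_ne_prod A B C] with z hz
    rw [← orthant _ _ (sub_ne_zero.2 hz.1) (sub_ne_zero.2 hz.2), ← integral_indicator_one]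
    · rfl
    · apply meas_two <;> fun_prop

end

lemma noAtoms_of {d : ℕ} (P : Measure (EuclideanSpace ℝ (Fin d)))
    (β : EuclideanSpace ℝ (Fin d)) (h : ∀ t : ℝ, projLaw P β {t} = 0) : NullSingletonClass P := by
  refine ⟨fun x => ?_⟩
  have := h ⟪β, x⟫
  rw [projLaw, Measure.map_apply (by fun_prop) (measurableSet_singleton _)] at this
  refine measure_mono_null ?_ this
  rintro y rfl
  simp

lemma lin3 {α : Type*} [MeasurableSpace α] (μ : Measure α) {f g h : α → ℝ}
    (hf : Integrable f μ) (hg : Integrable g μ) (hh : Integrable h μ) :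
    Integrable (fun a => f a - 2 * g a + h a) μ ∧
    ∫ a, (f a - 2 * g a + h a) ∂μ = ∫ a, f a ∂μ - 2 * ∫ a, g a ∂μ + ∫ a, h a ∂μ := by
  have h2 : Integrable (fun a => 2 * g a) μ := hg.const_mul 2
  have h3 : Integrable (fun a => f a - 2 * g a) μ := hf.sub h2
  refine ⟨h3.add hh, ?_⟩
  rw [integral_add h3 hh, integral_sub hf h2, integral_const_mul]

lemma cvm_inner {d : ℕ} (P Q : Measure (EuclideanSpace ℝ (Fin d)))
    [IsProbabilityMeasure P] [IsProbabilityMeasure Q] (ϑ : ℝ) (hϑ : ϑ ∈ Set.Ioo (0 : ℝ) 1)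
    (β : EuclideanSpace ℝ (Fin d)) :
    (∫ t, (projCDF P β t - projCDF Q β t) ^ 2
      ∂(projLaw (ENNReal.ofReal ϑ • P + ENNReal.ofReal (1 - ϑ) • Q) β))
    = ϑ * (II P P P β - 2 * II P Q P β + II Q Q P β)
      + (1 - ϑ) * (II P P Q β - 2 * II P Q Q β + II Q Q Q β) := by
  have e : ∀ t, (projCDF P β t - projCDF Q β t) ^ 2
      = projCDF P β t * projCDF P β t - 2 * (projCDF P β t * projCDF Q β t)
        + projCDF Q β t * projCDF Q β t := fun t => by ring
  have i : ∀ (μ : Measure ℝ) [IsFiniteMeasure μ], Integrable (fun t =>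
      projCDF P β t * projCDF P β t - 2 * (projCDF P β t * projCDF Q β t)
        + projCDF Q β t * projCDF Q β t) μ := fun μ _ =>
    (((integrable_mul_projCDF P P β μ)).sub ((integrable_mul_projCDF P Q β μ).const_mul 2)).add
      (integrable_mul_projCDF Q Q β μ)
  have j : ∀ (C : Measure (EuclideanSpace ℝ (Fin d))) [IsProbabilityMeasure C], ∫ t,
      (projCDF P β t * projCDF P β t - 2 * (projCDF P β t * projCDF Q β t)
        + projCDF Q β t * projCDF Q β t) ∂(projLaw C β)
      = II P P C β - 2 * II P Q C β + II Q Q C β := by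
    intro C _
    exact (lin3 _ (integrable_mul_projCDF P P β _) (integrable_mul_projCDF P Q β _)
      (integrable_mul_projCDF Q Q β _)).2
  simp_rw [e]
  have hl : projLaw (ENNReal.ofReal ϑ • P + ENNReal.ofReal (1 - ϑ) • Q) β
      = ENNReal.ofReal ϑ • projLaw P β + ENNReal.ofReal (1 - ϑ) • projLaw Q β := by
    rw [projLaw, Measure.map_add _ _ (by fun_prop), Measure.map_smul, Measure.map_smul]
    rfl
  rw [hl, integral_add_measure ((i _).smul_measure (by simp)) ((i _).smul_measure (by simp)),
    integral_smul_measure, integral_smul_measure, j P, j Q,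
    ENNReal.toReal_ofReal hϑ.1.le, ENNReal.toReal_ofReal (by linarith [hϑ.2])]
  simp only [smul_eq_mul]

/-- Six-term expression, Lemma for the CvM distance: under the continuity
assumption, with `X₁,X₂,X₃ ~ P` i.i.d. and independently `Y₁,Y₂,Y₃ ~ Q` i.i.d.,
`W_d²(P,Q) = (1/(2π)) E[Ang(X₁-X₂, Y₁-X₂)] + (1/(2π)) E[Ang(X₁-Y₂, Y₁-Y₂)]
  - (1/(4π)) E[Ang(X₁-X₃, X₂-X₃)] - (1/(4π)) E[Ang(X₁-Y₁, X₂-Y₁)]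
  - (1/(4π)) E[Ang(Y₁-Y₃, Y₂-Y₃)] - (1/(4π)) E[Ang(Y₁-X₁, Y₂-X₁)]`,
with expectations written as iterated integrals. -/
theorem stmt4 {d : ℕ} (P Q : Measure (EuclideanSpace ℝ (Fin d)))
    [IsProbabilityMeasure P] [IsProbabilityMeasure Q]
    (hc : ContinuityAssumption P Q) (ϑ : ℝ) (hϑ : ϑ ∈ Set.Ioo (0 : ℝ) 1) :
    cvmSq ϑ P Q
      = (1 / (2 * π)) * (∫ x1, ∫ x2, ∫ y1, Ang (x1 - x2) (y1 - x2) ∂Q ∂P ∂P)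
        + (1 / (2 * π)) * (∫ x1, ∫ y1, ∫ y2, Ang (x1 - y2) (y1 - y2) ∂Q ∂Q ∂P)
        - (1 / (4 * π)) * (∫ x1, ∫ x2, ∫ x3, Ang (x1 - x3) (x2 - x3) ∂P ∂P ∂P)
        - (1 / (4 * π)) * (∫ x1, ∫ x2, ∫ y1, Ang (x1 - y1) (x2 - y1) ∂Q ∂P ∂P)
        - (1 / (4 * π)) * (∫ y1, ∫ y2, ∫ y3, Ang (y1 - y3) (y2 - y3) ∂Q ∂Q ∂Q)
        - (1 / (4 * π)) * (∫ y1, ∫ y2, ∫ x1, Ang (y1 - x1) (y2 - x1) ∂P ∂Q ∂Q) := by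
  obtain ⟨β, hP, hQ⟩ := hc.exists
  have := noAtoms_of P β hP
  have := noAtoms_of Q β hQ
  have hW : cvmSq ϑ P Q = ϑ * ((1 / 2 - TT P P P / (2 * π)) - 2 * (1 / 2 - TT P Q P / (2 * π))
        + (1 / 2 - TT Q Q P / (2 * π)))
      + (1 - ϑ) * ((1 / 2 - TT P P Q / (2 * π)) - 2 * (1 / 2 - TT P Q Q / (2 * π))
        + (1 / 2 - TT Q Q Q / (2 * π))) := by
    simp_rw [← integral_II]
    rw [cvmSq]
    simp_rw [cvm_inner P Q ϑ hϑ]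
    have i1 := integrable_II P P P
    have i2 := integrable_II P Q P
    have i3 := integrable_II Q Q P
    have i4 := integrable_II P P Q
    have i5 := integrable_II P Q Q
    have i6 := integrable_II Q Q Q
    have l1 := lin3 _ i1 i2 i3
    have l2 := lin3 _ i4 i5 i6
    rw [integral_add (l1.1.const_mul ϑ) (l2.1.const_mul (1 - ϑ)),
      integral_const_mul, integral_const_mul, l1.2, l2.2]
  rw [hW, TT_swap23 P Q P]
  change _ = (1 / (2 * π)) * TT P Q P + (1 / (2 * π)) * TT P Q Q - (1 / (4 * π)) * TT P P P
    - (1 / (4 * π)) * TT P P Q - (1 / (4 * π)) * TT Q Q Q - (1 / (4 * π)) * TT Q Q P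
  have s1 := TT_sum P P
  have s2 := TT_sum Q Q
  have s3 := TT_sum P Q
  have s4 := TT_sum Q P
  rw [TT_symm Q P Q] at s4
  have hπ := pi_pos
  have t1 : TT P P P = π / 3 := by linarith
  have t2 : TT Q Q Q = π / 3 := by linarith
  have t3 : TT P Q P = (π - TT P P Q) / 2 := by linarith
  have t4 : TT P Q Q = (π - TT Q Q P) / 2 := by linarith
  rw [t1, t2, t3, t4]
  field_simp
  ring
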